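/- arXiv:2010.13941 — 3 statements merged into one kernel-verified Lean document; each statement's English description precedes it below -/
import Mathlib

section
/- Let A be a 2×2 integer matrix whose characteristic polynomial factors over ℤ as (X − λ)(X − μ) with λ, μ ∈ ℤ. Then there exist a 2×2 integer matrix P with det P = 1 and an integer t such that P * A * P⁻¹ is the matrix [[μ, 0], [t, λ]] (rows (μ, 0) and (t, λ)). -/
/-- Every integer linear form in two variables has a primitive zero. -/
theorem exists_primitive_zero (p q : ℤ) :
    ∃ x y z w : ℤ, x * w - y * z = 1 ∧ x * p + y * q = 0 := by
  by_cases hg : Int.gcd p q = 0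
  · obtain ⟨rfl, rfl⟩ := Int.gcd_eq_zero_iff.mp hg
    exact ⟨1, 0, 0, 1, by norm_num, by norm_num⟩
  · have hg' : (Int.gcd p q : ℤ) ≠ 0 := by exact_mod_cast hg
    obtain ⟨p', hp⟩ := Int.gcd_dvd_left p q
    obtain ⟨q', hq⟩ := Int.gcd_dvd_right p q
    have hb := Int.gcd_eq_gcd_ab p q
    generalize (Int.gcd p q : ℤ) = g at *
    generalize Int.gcdA p q = u at *
    generalize Int.gcdB p q = v at *
    subst hp
    refine ⟨q', -p', u, v, ?_, ?_⟩
    · apply mul_left_cancel₀ hg'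
      rw [hq] at hb
      linear_combination -hb
    · rw [hq]; ring

/-- Lemma 3.1 context: a 2×2 integer matrix whose characteristic polynomial
factors over ℤ as (X − λ)(X − μ) is conjugate in SL(2,ℤ) to the
lower-triangular matrix [[μ, 0], [t, λ]] for some t ∈ ℤ. -/
theorem stmt_0 (A : Matrix (Fin 2) (Fin 2) ℤ) (lam mu : ℤ)
    (h : A.charpoly = (Polynomial.X - Polynomial.C lam) * (Polynomial.X - Polynomial.C mu)) :
    ∃ (P : Matrix (Fin 2) (Fin 2) ℤ) (t : ℤ),
      P.det = 1 ∧ P * A * P⁻¹ = !![mu, 0; t, lam] := by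
  obtain ⟨a, b, c, d, rfl⟩ : ∃ a b c d, A = !![a, b; c, d] :=
    ⟨_, _, _, _, Matrix.eta_fin_two A⟩
  rw [Matrix.charpoly_fin_two] at h
  have h0 := congrArg (Polynomial.eval 0) h
  have h1 := congrArg (Polynomial.eval 1) h
  simp [Matrix.trace_fin_two, Matrix.det_fin_two] at h0 h1
  have htr : a + d = lam + mu := by linear_combination h0 - h1
  have hdet : (a - mu) * (d - mu) = b * c := by
    linear_combination h0 - mu * htr
  have key : ∃ x y z w : ℤ, x * w - y * z = 1 ∧ x * (a - mu) + y * c = 0 ∧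
      x * b + y * (d - mu) = 0 := by
    by_cases hz : a - mu = 0 ∧ c = 0
    · obtain ⟨x, y, z, w, e1, e2⟩ := exists_primitive_zero b (d - mu)
      exact ⟨x, y, z, w, e1, by rw [hz.1, hz.2]; ring, e2⟩
    · obtain ⟨x, y, z, w, e1, e2⟩ := exists_primitive_zero (a - mu) c
      refine ⟨x, y, z, w, e1, e2, ?_⟩
      by_cases hc : c = 0
      · have ha : a - mu ≠ 0 := fun k => hz ⟨k, hc⟩
        apply mul_left_cancel₀ ha
        linear_combination b * e2 + y * hdet
      · apply mul_left_cancel₀ hc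
        linear_combination (d - mu) * e2 - x * hdet
  obtain ⟨x, y, z, w, e1, e2, e3⟩ := key
  have hP : (!![x, y; z, w] : Matrix (Fin 2) (Fin 2) ℤ).det = 1 := by
    rw [Matrix.det_fin_two_of]; exact e1
  refine ⟨!![x, y; z, w], (z * a + w * c) * w - (z * b + w * d) * z, hP, ?_⟩
  rw [Matrix.inv_def, hP, Matrix.adjugate_fin_two_of]
  ext i j
  fin_cases i <;> fin_cases j <;> simp [Matrix.mul_apply, Fin.sum_univ_two]
  · linear_combination w * e2 - z * e3 + mu * e1
  · linear_combination -y * e2 + x * e3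
  · ring
  · linear_combination -w * e2 + z * e3 + (a + d - mu) * e1 + htr
end

section
/- Let a > 0 and C > 0, let B : ℝ² → ℝ² be the linear map B(x, y) = (4x, 2x + 3y), and let F : ℝ² → ℝ² be a bijection such that ‖F(v) − B(v)‖ ≤ C for all v ∈ ℝ² and such that F((−a, a) × ℝ) = (−a, a) × ℝ. Then for every r₀ > 0 there exists r > 0 such that for every n ≥ 0, the n-fold preimage F⁻ⁿ((−a, a) × (−r₀, r₀)) is contained in ℝ × (−r, r). -/
/-- Lemma 2.7: if F is a bijection of the plane at uniformly bounded distance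
from the linear map B(x,y) = (4x, 2x+3y) and F preserves the strip
(−a,a) × ℝ, then for every r₀ > 0 there is r > 0 such that all backward
iterates of (−a,a) × (−r₀,r₀) under F stay in ℝ × (−r,r). -/
theorem stmt_7 (a C : ℝ) (ha : 0 < a) (hC : 0 < C)
    (B F : EuclideanSpace ℝ (Fin 2) → EuclideanSpace ℝ (Fin 2))
    (hB : ∀ v, B v = ![4 * v 0, 2 * v 0 + 3 * v 1])
    (hFbij : Function.Bijective F)
    (hdist : ∀ v, ‖F v - B v‖ ≤ C)
    (hstrip : F '' {v | v 0 ∈ Set.Ioo (-a) a} = {v | v 0 ∈ Set.Ioo (-a) a}) :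
    ∀ r₀ > 0, ∃ r > 0, ∀ n : ℕ,
      F^[n] ⁻¹' {v | v 0 ∈ Set.Ioo (-a) a ∧ v 1 ∈ Set.Ioo (-r₀) r₀} ⊆
        {v | v 1 ∈ Set.Ioo (-r) r} := by
  intro r₀ hr₀
  have step : ∀ v : EuclideanSpace ℝ (Fin 2),
      (F v 0 ∈ Set.Ioo (-a) a ∧ F v 1 ∈ Set.Ioo (-(r₀ + 2 * a + C)) (r₀ + 2 * a + C)) →
      (v 0 ∈ Set.Ioo (-a) a ∧ v 1 ∈ Set.Ioo (-(r₀ + 2 * a + C)) (r₀ + 2 * a + C)) := by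
    rintro v ⟨h0, h1⟩
    have hm : F v ∈ F '' {v | v 0 ∈ Set.Ioo (-a) a} := by
      rw [hstrip]; exact h0
    obtain ⟨w, hw, hwv⟩ := hm
    have hv : v 0 ∈ Set.Ioo (-a) a := by
      rw [← hFbij.1 hwv]; exact hw
    refine ⟨hv, ?_⟩
    have h2 : ‖(F v - B v) 1‖ ≤ C := (PiLp.norm_apply_le _ _).trans (hdist v)
    have h3 : B v 1 = 2 * v 0 + 3 * v 1 := by
      have := congrFun (hB v) 1
      simpa using this
    rw [PiLp.sub_apply, h3, Real.norm_eq_abs, abs_le] at h2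
    obtain ⟨h4, h5⟩ := h2
    obtain ⟨h6, h7⟩ := hv
    obtain ⟨h8, h9⟩ := h1
    constructor <;> linarith
  refine ⟨r₀ + 2 * a + C, by positivity, fun n v hv => ?_⟩
  have main : ∀ (n : ℕ) (v : EuclideanSpace ℝ (Fin 2)),
      (F^[n] v 0 ∈ Set.Ioo (-a) a ∧
        F^[n] v 1 ∈ Set.Ioo (-(r₀ + 2 * a + C)) (r₀ + 2 * a + C)) →
      (v 0 ∈ Set.Ioo (-a) a ∧ v 1 ∈ Set.Ioo (-(r₀ + 2 * a + C)) (r₀ + 2 * a + C)) := by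
    intro n
    induction n with
    | zero => intro v h; exact h
    | succ k ih =>
      intro v h
      rw [Function.iterate_succ_apply] at h
      exact step v (ih _ h)
  obtain ⟨h0, h1, h2⟩ := hv
  exact (main n v ⟨h0, by linarith, by linarith⟩).2
end

section
/- Let 0 < a < 1/4 and let g̃ : ℝ → ℝ be a continuous, strictly increasing function such that g̃(x + 1) = g̃(x) + 4 for all x, g̃(a) = a, g̃(−a) = −a, and g̃(y) − g̃(x) ≥ 4·(y − x) whenever a ≤ x ≤ y ≤ 1 − a. Let S = ⋃_{k ∈ ℤ} [k − a, k + a]. Then the union ⋃_{n ≥ 0} g̃⁻ⁿ(S) of all backward iterates of S under g̃ is dense in ℝ. -/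
/-- Density claim from the proof of Theorem 1.1: for a lift g̃ of a monotone
degree-4 circle map that fixes ±a and expands by a factor of at least 4
outside [−a, a], the union of all backward iterates of
S = ⋃ₖ [k−a, k+a] is dense in ℝ. -/
theorem stmt_8 (a : ℝ) (ha0 : 0 < a) (ha : a < 1/4)
    (g : ℝ → ℝ) (hcont : Continuous g) (hmono : StrictMono g)
    (hdeg : ∀ x, g (x + 1) = g x + 4)
    (hfixa : g a = a) (hfixa' : g (-a) = -a)
    (hexp : ∀ x y : ℝ, a ≤ x → x ≤ y → y ≤ 1 - a → g y - g x ≥ 4 * (y - x)) :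
    Dense (⋃ n : ℕ, g^[n] ⁻¹' (⋃ k : ℤ, Set.Icc ((k : ℝ) - a) ((k : ℝ) + a))) := by
  have hZ : ∀ (k : ℤ) (x : ℝ), g (x + k) = g x + 4 * k := by
    intro k
    induction k using Int.induction_on with
    | zero => intro x; simp
    | succ i ih =>
      intro x
      have h1 := hdeg (x + i)
      have h2 := ih x
      push_cast at h2 ⊢
      rw [← add_assoc, h1, h2]; ring
    | pred i ih =>
      intro x
      have h1 := hdeg (x + (-(i : ℝ) - 1))
      have h2 := ih x
      push_cast at h2 ⊢
      have h3 : x + (-(i : ℝ) - 1) + 1 = x + -i := by ring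
      rw [h3, h2] at h1
      linarith
  have key : ∀ X Y : ℝ, X ≤ Y →
      (∀ z ∈ Set.Icc X Y, z ∉ ⋃ k : ℤ, Set.Icc ((k : ℝ) - a) ((k : ℝ) + a)) →
      4 * (Y - X) ≤ g Y - g X ∧ Y - X < 1 := by
    intro X Y hXY hd
    have hf1 := Int.floor_le X
    have hf2 := Int.lt_floor_add_one X
    generalize ⌊X⌋ = k at hf1 hf2
    have hX : (k : ℝ) + a < X := by
      by_contra h
      exact hd X ⟨le_rfl, hXY⟩ (Set.mem_iUnion.2 ⟨k, by linarith, by linarith⟩)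
    have hX2 : X < k + 1 - a := by
      by_contra h
      exact hd X ⟨le_rfl, hXY⟩ (Set.mem_iUnion.2
        ⟨k + 1, by push_cast; linarith, by push_cast; linarith⟩)
    have hY : Y < k + 1 - a := by
      by_contra h
      exact hd (k + 1 - a) ⟨by linarith, by linarith⟩ (Set.mem_iUnion.2
        ⟨k + 1, by push_cast; linarith, by push_cast; linarith⟩)
    have h1 := hexp (X - k) (Y - k) (by linarith) (by linarith) (by linarith)
    have h2 := hZ k (X - k)
    have h3 := hZ k (Y - k)
    rw [sub_add_cancel] at h2 h3
    exact ⟨by linarith, by linarith⟩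
  rw [Metric.dense_iff]
  intro x r hr
  by_contra hne
  rw [Set.not_nonempty_iff_eq_empty, Set.eq_empty_iff_forall_notMem] at hne
  have hav : ∀ n : ℕ, ∀ z ∈ Set.Icc (g^[n] x) (g^[n] (x + r / 2)),
      z ∉ ⋃ k : ℤ, Set.Icc ((k : ℝ) - a) ((k : ℝ) + a) := by
    intro n z hz hzS
    obtain ⟨w, hw, rfl⟩ := intermediate_value_Icc (by linarith : x ≤ x + r / 2)
      (hcont.iterate n).continuousOn hz
    refine hne w ⟨?_, Set.mem_iUnion.2 ⟨n, hzS⟩⟩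
    rw [Metric.mem_ball, Real.dist_eq, abs_lt]
    constructor <;> linarith [hw.1, hw.2]
  have hle : ∀ n : ℕ, g^[n] x ≤ g^[n] (x + r / 2) := fun n =>
    (hmono.monotone.iterate n) (by linarith)
  have hgrow : ∀ n : ℕ, 4 ^ n * (r / 2) ≤ g^[n] (x + r / 2) - g^[n] x := by
    intro n
    induction n with
    | zero => simp
    | succ n ih =>
      have := (key _ _ (hle n) (hav n)).1
      rw [Function.iterate_succ_apply', Function.iterate_succ_apply', pow_succ]
      linarith
  obtain ⟨n, hn⟩ := pow_unbounded_of_one_lt (1 / (r / 2)) (by norm_num : (1 : ℝ) < 4)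
  rw [div_lt_iff₀ (by linarith)] at hn
  linarith [hgrow n, (key _ _ (hle n) (hav n)).2]
end
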